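/- Let E be a finite-dimensional complex vector space with a non-degenerate symmetric bilinear form ⟨·,·⟩. There is a bijection between (a) the set of positive-definite Hermitian forms [·,·] on E such that the ℝ-linear map θ defined by [u,v] = ⟨u, θv⟩ satisfies θ² = 1, and (b) the set of real forms E₀ of E (real subspaces with E = E₀ ⊕ iE₀) on which ⟨·,·⟩ restricts to a real-valued positive-definite form; the bijection sends [·,·] to the +1-eigenspace of θ. -/

import Mathlib

open Complex

theorem aux_rsmul {E : Type*} [AddCommGroup E] [Module ℂ E] [Module ℝ E] [IsScalarTower ℝ ℂ E]
    (r : ℝ) (v : E) : r • v = (r : ℂ) • v := (algebraMap_smul ℂ r v).symm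

theorem aux_decomp {E : Type*} [AddCommGroup E] [Module ℂ E] [Module ℝ E] [IsScalarTower ℝ ℂ E]
    (θ : E →ₗ[ℝ] E) (h1 : ∀ (c : ℂ) (v : E), θ (c • v) = (starRingEnd ℂ c) • θ v)
    (h2 : ∀ v, θ (θ v) = v) (v : E) :
    ∃ a b : E, θ a = a ∧ θ b = b ∧ v = a + Complex.I • b := by
  refine ⟨(1 / 2 : ℂ) • (v + θ v), (-Complex.I / 2 : ℂ) • (v - θ v), ?_, ?_, ?_⟩
  · rw [h1, map_add, h2, add_comm]; simp only [map_div₀, map_one, map_ofNat]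
  · rw [h1, map_sub, h2]; simp only [map_div₀, map_neg, Complex.conj_I, map_ofNat]; module
  · rw [smul_smul, show Complex.I * (-Complex.I / 2) = 1 / 2 by
      linear_combination (-1/2 : ℂ) * Complex.I_mul_I]
    module

theorem aux_apply {E : Type*} [AddCommGroup E] [Module ℂ E] [Module ℝ E]
    (θ : E →ₗ[ℝ] E) (h1 : ∀ (c : ℂ) (v : E), θ (c • v) = (starRingEnd ℂ c) • θ v)
    (a b : E) (ha : θ a = a) (hb : θ b = b) :
    θ (a + Complex.I • b) = a - Complex.I • b := by
  rw [map_add, h1, ha, hb, Complex.conj_I, neg_smul, sub_eq_add_neg]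

theorem aux_uniq {E : Type*} [AddCommGroup E] [Module ℂ E] 
    (a b c d : E) (h : a + Complex.I • b = c + Complex.I • d)
    (h' : a - Complex.I • b = c - Complex.I • d) : a = c ∧ b = d := by
  have hac : a = c := by
    have : (1/2 : ℂ) • ((a + Complex.I • b) + (a - Complex.I • b))
      = (1/2 : ℂ) • ((c + Complex.I • d) + (c - Complex.I • d)) := by rw [h, h']
    have e1 : ∀ x y : E, (1/2 : ℂ) • ((x + y) + (x - y)) = x := by intro x y; module
    rwa [e1, e1] at this
  subst hac
  exact ⟨rfl, smul_right_injective E Complex.I_ne_zero (add_left_cancel h)⟩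

theorem aux_surj {E : Type*} [AddCommGroup E] [Module ℂ E] [Module ℝ E] [IsScalarTower ℝ ℂ E]
    (E₀ : Submodule ℝ E)
    (h : ∀ v : E, ∃! p : E₀ × E₀, v = (p.1 : E) + Complex.I • (p.2 : E)) :
    ∃ θ : E →ₗ[ℝ] E, (∀ a ∈ E₀, ∀ b ∈ E₀, θ (a + Complex.I • b) = a - Complex.I • b) := by
  choose p hp hu using h
  have key : ∀ a b : E₀, p (a + Complex.I • (b : E)) = (a, b) :=
    fun a b => (hu _ (a, b) rfl).symm
  refine ⟨{ toFun := fun v => (p v).1 - Complex.I • ((p v).2 : E)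
            map_add' := ?_
            map_smul' := ?_ }, ?_⟩
  · intro x y
    have : p (x + y) = p x + p y := by
      refine (hu _ (p x + p y) ?_).symm
      change x + y = ((p x + p y).1 : E) + Complex.I • ((p x + p y).2 : E)
      conv_lhs => rw [hp x, hp y]
      simp only [Prod.fst_add, Prod.snd_add, Submodule.coe_add]
      module
    simp only [this, Prod.fst_add, Prod.snd_add, Submodule.coe_add]
    module
  · intro r x
    have : p (r • x) = r • p x := by
      refine (hu _ (r • p x) ?_).symm
      change r • x = ((r • p x).1 : E) + Complex.I • ((r • p x).2 : E)
      conv_lhs => rw [hp x]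
      simp only [Prod.smul_fst, Prod.smul_snd, Submodule.coe_smul, aux_rsmul]
      module
    simp only [this]
    simp only [Prod.smul_fst, Prod.smul_snd, Submodule.coe_smul, aux_rsmul, RingHom.id_apply]
    module
  · intro a ha b hb
    have := key ⟨a, ha⟩ ⟨b, hb⟩
    simp only at this
    simp [this]

/-- Let `E` be a finite-dimensional complex vector space with a
non-degenerate symmetric bilinear form `B`.  There is a bijection between
(a) commuting positive (Hermitian positive-definite) forms on `E`, encoded by the
ℝ-linear map `θ` with `[u,v] = B u (θ v)`, `θ` conjugate-linear, `θ² = 1`, the form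
Hermitian and positive definite; and (b) real forms `E₀` of `E` on which `B` is
real-valued and positive definite; the bijection sends `θ` to its `+1`-eigenspace. -/
theorem commuting_positive_forms_equiv_real_forms
    (E : Type*) [AddCommGroup E] [Module ℂ E] [FiniteDimensional ℂ E]
    [Module ℝ E] [IsScalarTower ℝ ℂ E]
    (B : E →ₗ[ℂ] E →ₗ[ℂ] ℂ)
    (hsymm : ∀ u v, B u v = B v u)
    (hnd : ∀ u, (∀ v, B u v = 0) → u = 0) :
    ∃ e :
      {θ : E →ₗ[ℝ] E //
          (∀ (c : ℂ) (v : E), θ (c • v) = (starRingEnd ℂ c) • θ v) ∧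
          (∀ v, θ (θ v) = v) ∧
          (∀ u v, B u (θ v) = starRingEnd ℂ (B v (θ u))) ∧
          (∀ u : E, u ≠ 0 → 0 < (B u (θ u)).re ∧ (B u (θ u)).im = 0)} ≃
      {E₀ : Submodule ℝ E //
          (∀ v : E, ∃! p : E₀ × E₀, v = (p.1 : E) + Complex.I • (p.2 : E)) ∧
          (∀ u ∈ E₀, ∀ v ∈ E₀, (B u v).im = 0) ∧
          (∀ u ∈ E₀, u ≠ 0 → 0 < (B u u).re)},
      ∀ θ, (e θ : Submodule ℝ E) = {u : E | θ.1 u = u} := by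
  have fwd : ∀ θ : {θ : E →ₗ[ℝ] E //
          (∀ (c : ℂ) (v : E), θ (c • v) = (starRingEnd ℂ c) • θ v) ∧
          (∀ v, θ (θ v) = v) ∧
          (∀ u v, B u (θ v) = starRingEnd ℂ (B v (θ u))) ∧
          (∀ u : E, u ≠ 0 → 0 < (B u (θ u)).re ∧ (B u (θ u)).im = 0)},
      ∃ F : {E₀ : Submodule ℝ E //
          (∀ v : E, ∃! p : E₀ × E₀, v = (p.1 : E) + Complex.I • (p.2 : E)) ∧
          (∀ u ∈ E₀, ∀ v ∈ E₀, (B u v).im = 0) ∧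
          (∀ u ∈ E₀, u ≠ 0 → 0 < (B u u).re)}, ∀ u, u ∈ F.1 ↔ θ.1 u = u := by
    rintro ⟨θ, h1, h2, h3, h4⟩
    refine ⟨⟨LinearMap.eqLocus θ LinearMap.id, ?_, ?_, ?_⟩, ?_⟩
    · intro v
      obtain ⟨a, b, ha, hb, hv⟩ := aux_decomp θ h1 h2 v
      refine ⟨(⟨a, ha⟩, ⟨b, hb⟩), hv, ?_⟩
      rintro ⟨⟨c, hc⟩, ⟨d, hd⟩⟩ hv'
      have hc' : θ c = c := hc
      have hd' : θ d = d := hd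
      have hv'' : v = c + Complex.I • d := hv'
      have e := aux_uniq c d a b (hv''.symm.trans hv) (by
        rw [← aux_apply θ h1 c d hc' hd', ← aux_apply θ h1 a b ha hb, ← hv, ← hv''])
      obtain ⟨rfl, rfl⟩ := e
      rfl
    · intro u hu v hv
      have hu' : θ u = u := hu
      have hv' : θ v = v := hv
      have := h3 u v
      rw [hu', hv', hsymm v u] at this
      exact Complex.conj_eq_iff_im.mp this.symm
    · intro u hu hne
      have hu' : θ u = u := hu
      have := (h4 u hne).1
      rwa [hu'] at this
    · intro u; exact Iff.rfl
  choose f hf using fwd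
  refine ⟨Equiv.ofBijective f ⟨?_, ?_⟩, fun θ => Set.ext fun u => hf θ u⟩
  · intro θ η h
    apply Subtype.ext
    ext v
    obtain ⟨a, b, ha, hb, hv⟩ := aux_decomp θ.1 θ.2.1 θ.2.2.1 v
    have ha' : η.1 a = a := by rw [← hf, ← h, hf]; exact ha
    have hb' : η.1 b = b := by rw [← hf, ← h, hf]; exact hb
    rw [hv, aux_apply _ θ.2.1 a b ha hb, aux_apply _ η.2.1 a b ha' hb']
  · rintro ⟨E₀, g1, g2, g3⟩
    obtain ⟨θ, hθ⟩ := aux_surj E₀ g1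
    have dec : ∀ v, ∃ a ∈ E₀, ∃ b ∈ E₀, v = a + Complex.I • b := by
      intro v
      obtain ⟨p, hp, -⟩ := g1 v
      exact ⟨p.1, p.1.2, p.2, p.2.2, hp⟩
    have expand : ∀ a b c d : E, B (a + Complex.I • b) (c - Complex.I • d)
        = B a c + B b d + Complex.I * (B b c - B a d) := by
      intro a b c d
      simp only [map_add, map_sub, map_smul, LinearMap.add_apply, LinearMap.smul_apply, smul_eq_mul]
      linear_combination (-B b d) * Complex.I_mul_I
    have real : ∀ u ∈ E₀, ∀ v ∈ E₀, starRingEnd ℂ (B u v) = B u v := fun u hu v hv =>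
      Complex.conj_eq_iff_im.mpr (g2 u hu v hv)
    have fix : ∀ a ∈ E₀, θ a = a := by
      intro a ha
      simpa using hθ a ha 0 E₀.zero_mem
    have nonneg : ∀ a ∈ E₀, 0 ≤ (B a a).re := by
      intro a ha
      by_cases h0 : a = 0
      · simp [h0]
      · exact (g3 a ha h0).le
    refine ⟨⟨θ, ?_, ?_, ?_, ?_⟩, ?_⟩
    · intro c v
      obtain ⟨a, ha, b, hb, rfl⟩ := dec v
      have e : c • (a + Complex.I • b)
          = (c.re • a - c.im • b) + Complex.I • (c.im • a + c.re • b) := by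
        conv_lhs => rw [← Complex.re_add_im c]
        simp only [aux_rsmul]
        match_scalars
        · ring
        · linear_combination (c.im : ℂ) * Complex.I_mul_I
      rw [e, hθ _ (E₀.sub_mem (E₀.smul_mem _ ha) (E₀.smul_mem _ hb)) _
        (E₀.add_mem (E₀.smul_mem _ ha) (E₀.smul_mem _ hb)), hθ a ha b hb]
      have e2 : starRingEnd ℂ c = (c.re : ℂ) - c.im * Complex.I := by
        apply Complex.ext <;> simp
      rw [e2]
      simp only [aux_rsmul]
      match_scalars
      · ring
      · linear_combination (-c.im : ℂ) * Complex.I_mul_I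
    · intro v
      obtain ⟨a, ha, b, hb, rfl⟩ := dec v
      rw [hθ a ha b hb]
      have := hθ a ha (-b) (E₀.neg_mem hb)
      simpa [sub_eq_add_neg] using this
    · intro u v
      obtain ⟨a, ha, b, hb, rfl⟩ := dec u
      obtain ⟨c, hc, d, hd, rfl⟩ := dec v
      rw [hθ a ha b hb, hθ c hc d hd, expand, expand]
      simp only [map_add, map_mul, map_sub, Complex.conj_I, real c hc a ha, real d hd b hb,
        real d hd a ha, real c hc b hb]
      rw [hsymm c a, hsymm d b, hsymm d a, hsymm c b]
      ring
    · intro u hu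
      obtain ⟨a, ha, b, hb, rfl⟩ := dec u
      rw [hθ a ha b hb, expand, hsymm b a, sub_self, mul_zero, add_zero]
      refine ⟨?_, by rw [Complex.add_im, g2 a ha a ha, g2 b hb b hb, add_zero]⟩
      rw [Complex.add_re]
      by_cases h0 : a = 0
      · have hb0 : b ≠ 0 := by
          rintro rfl
          exact hu (by simp [h0])
        exact add_pos_of_nonneg_of_pos (nonneg a ha) (g3 b hb hb0)
      · exact add_pos_of_pos_of_nonneg (g3 a ha h0) (nonneg b hb)
    · apply Subtype.ext
      ext u
      rw [hf]
      refine ⟨fun h => ?_, fun h => fix u h⟩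
      obtain ⟨a, ha, b, hb, rfl⟩ := dec u
      have h' : θ (a + Complex.I • b) = a + Complex.I • b := h
      rw [hθ a ha b hb] at h'
      have hb0 : b = 0 := by
        have h2 := aux_uniq a b a (-b) (by rw [smul_neg, ← sub_eq_add_neg]; exact h'.symm)
          (by rw [smul_neg, sub_neg_eq_add]; exact h')
        have h3 : (2 : ℂ) • b = 0 := by
          rw [two_smul]; nth_rewrite 1 [h2.2]; simp
        simpa using h3
      simpa [hb0] using ha
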